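/- Let C be a category with chosen finite products and let P : Cᵒᵖ → InfSL be an elementary doctrine, with δ_X ∈ P(X×X) satisfying: (1) ⊤_X ≤ P_{Δ_X}(δ_X); (2) for every α ∈ P(X), P_{p₁}(α) ∧ δ_X ≤ P_{p₂}(α); (3) for all X, Y, P_{⟨p₁,p₃⟩}(δ_X) ∧ P_{⟨p₂,p₄⟩}(δ_Y) ≤ δ_{X×Y} (where p₁,…,p₄ are the projections of (X×Y)×(X×Y)). For every object X and every weak product (W, 𝗉₁, 𝗉₂ : W → X) of X with itself, define δ⟨X,𝗉⟩ := P_{⟨𝗉₁,𝗉₂⟩}(δ_X), where ⟨𝗉₁,𝗉₂⟩ : W → X×X is the unique arrow into the strict product with components 𝗉₁, 𝗉₂. Then the family δ⟨X,𝗉⟩ satisfies the four conditions of a biased elementary doctrine; hence every elementary doctrine is a biased elementary doctrine. -/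

import Mathlib

open CategoryTheory Opposite

universe w v u

variable {C : Type u} [Category.{v} C]

/-- A weak binary product diagram: every pair of arrows factors (not necessarily
uniquely) through the projections. -/
def IsWeakPair {W X Y : C} (p₁ : W ⟶ X) (p₂ : W ⟶ Y) : Prop :=
  ∀ {A : C} (f : A ⟶ X) (g : A ⟶ Y), ∃ h : A ⟶ W, h ≫ p₁ = f ∧ h ≫ p₂ = g

/-- A weak product of a finite family of objects. -/
def IsWeakFan {n : ℕ} {X : Fin n → C} {W : C} (p : ∀ i, W ⟶ X i) : Prop :=
  ∀ {A : C} (f : ∀ i, A ⟶ X i), ∃ h : A ⟶ W, ∀ i, h ≫ p i = f i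

/-- A weak terminal object. -/
def IsWeakTerminal (T : C) : Prop := ∀ X : C, Nonempty (X ⟶ T)

/-- A category has weak finite products if it has a weak terminal object and
weak binary products. -/
def HasWeakFiniteProducts (C : Type u) [Category.{v} C] : Prop :=
  (∃ T : C, IsWeakTerminal T) ∧
    ∀ X Y : C, ∃ (W : C) (p₁ : W ⟶ X) (p₂ : W ⟶ Y), IsWeakPair p₁ p₂

/-- A biased elementary doctrine: a functor `P : Cᵒᵖ ⥤ InfSL` together with a biased
fibered equality `δ⟨X,p⟩` for every weak product of an object with itself, satisfying
the four conditions of Definition 3.2 of "Biased elementary doctrines and quotient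
completions". -/
structure BiasedElementaryDoctrine (C : Type u) [Category.{v} C] where
  P : Cᵒᵖ ⥤ SemilatInfCat.{w}
  δ : ∀ {X W : C} {p₁ p₂ : W ⟶ X}, IsWeakPair p₁ p₂ → P.obj (op W)
  cond₁ : ∀ {X W : C} {p₁ p₂ : W ⟶ X} (hp : IsWeakPair p₁ p₂) (d : X ⟶ W),
      d ≫ p₁ = 𝟙 X → d ≫ p₂ = 𝟙 X → ⊤ ≤ P.map d.op (δ hp)
  cond₂ : ∀ {X W : C} {p₁ p₂ : W ⟶ X} (hp : IsWeakPair p₁ p₂) (α : P.obj (op X)),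
      P.map p₁.op α ⊓ δ hp ≤ P.map p₂.op α
  cond₃ : ∀ {X X' W W' : C} {p₁ p₂ : W ⟶ X} {p'₁ p'₂ : W' ⟶ X'}
      (hp : IsWeakPair p₁ p₂) (hp' : IsWeakPair p'₁ p'₂) (f : X' ⟶ X) (g : W' ⟶ W),
      g ≫ p₁ = p'₁ ≫ f → g ≫ p₂ = p'₂ ≫ f → δ hp' ≤ P.map g.op (δ hp)
  cond₄ : ∀ {X W U : C} {p₁ p₂ : W ⟶ X} {r₁ r₂ : U ⟶ W}
      (hp : IsWeakPair p₁ p₂) (_hr : IsWeakPair r₁ r₂) (t t' : U ⟶ W),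
      t ≫ p₁ = r₁ ≫ p₁ → t ≫ p₂ = r₂ ≫ p₁ →
      t' ≫ p₁ = r₁ ≫ p₂ → t' ≫ p₂ = r₂ ≫ p₂ →
      P.map r₁.op (δ hp) ⊓ P.map t.op (δ hp) ⊓ P.map t'.op (δ hp) ≤ P.map r₂.op (δ hp)

open Limits

section Helpers

variable [HasFiniteProducts C] (P : Cᵒᵖ ⥤ SemilatInfCat.{w})

theorem bed_map_comp {X Y Z : C} (f : X ⟶ Y) (g : Y ⟶ Z) (α : P.obj (op Z)) :
    P.map f.op (P.map g.op α) = P.map (f ≫ g).op α := by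
  rw [op_comp, P.map_comp]; rfl

theorem bed_map_inf {X Y : C} (f : X ⟶ Y) (α β : P.obj (op Y)) :
    P.map f.op (α ⊓ β) = P.map f.op α ⊓ P.map f.op β :=
  InfHom.map_inf' (InfTopHom.toInfHom (P.map f.op)) α β

theorem bed_map_top {X Y : C} (f : X ⟶ Y) :
    P.map f.op (⊤ : P.obj (op Y)) = ⊤ :=
  InfTopHom.map_top' (P.map f.op)

theorem bed_map_mono {X Y : C} (f : X ⟶ Y) {α β : P.obj (op Y)} (h : α ≤ β) :
    P.map f.op α ≤ P.map f.op β := by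
  rw [← inf_eq_left] at h ⊢
  rw [← bed_map_inf, h]

variable (δ : ∀ X : C, (P.obj (op (X ⨯ X)) : Type w))

theorem bed_refl (h1 : ∀ X : C, ⊤ ≤ P.map (diag X).op (δ X)) {A X : C} (a : A ⟶ X) :
    ⊤ ≤ P.map (prod.lift a a).op (δ X) := by
  have h := bed_map_mono P a (h1 X)
  rw [bed_map_top, bed_map_comp] at h
  have e : a ≫ diag X = prod.lift a a := by ext <;> simp
  rwa [e] at h

theorem bed_subst (h2 : ∀ (X : C) (α : P.obj (op X)),
      P.map (prod.fst : X ⨯ X ⟶ X).op α ⊓ δ X ≤ P.map (prod.snd : X ⨯ X ⟶ X).op α)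
    {A X : C} (a b : A ⟶ X) (α : P.obj (op X)) :
    P.map a.op α ⊓ P.map (prod.lift a b).op (δ X) ≤ P.map b.op α := by
  have h := bed_map_mono P (prod.lift a b) (h2 X α)
  rwa [bed_map_inf, bed_map_comp, bed_map_comp, prod.lift_fst, prod.lift_snd] at h

theorem bed_pair (h3 : ∀ X Y : C,
      P.map (prod.map (prod.fst : X ⨯ Y ⟶ X) (prod.fst : X ⨯ Y ⟶ X)).op (δ X)
          ⊓ P.map (prod.map (prod.snd : X ⨯ Y ⟶ Y) (prod.snd : X ⨯ Y ⟶ Y)).op (δ Y)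
        ≤ δ (X ⨯ Y))
    {A X Y : C} (a b : A ⟶ X) (c d : A ⟶ Y) :
    P.map (prod.lift a b).op (δ X) ⊓ P.map (prod.lift c d).op (δ Y)
      ≤ P.map (prod.lift (prod.lift a c) (prod.lift b d)).op (δ (X ⨯ Y)) := by
  have h := bed_map_mono P (prod.lift (prod.lift a c) (prod.lift b d)) (h3 X Y)
  rw [bed_map_inf, bed_map_comp, bed_map_comp, prod.lift_map, prod.lift_map] at h
  simpa only [prod.lift_fst, prod.lift_snd] using h

end Helpers


/-- Every elementary doctrine is a biased elementary doctrine: the family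
`δ⟨X,p⟩ := P_{⟨p₁,p₂⟩}(δ_X)` satisfies the four conditions of a biased elementary
doctrine. -/
theorem elementary_is_biasedElementary [HasFiniteProducts C]
    (P : Cᵒᵖ ⥤ SemilatInfCat.{w})
    (δ : ∀ X : C, (P.obj (op (X ⨯ X)) : Type w))
    (h1 : ∀ X : C, ⊤ ≤ P.map (diag X).op (δ X))
    (h2 : ∀ (X : C) (α : P.obj (op X)),
      P.map (prod.fst : X ⨯ X ⟶ X).op α ⊓ δ X ≤ P.map (prod.snd : X ⨯ X ⟶ X).op α)
    (h3 : ∀ X Y : C,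
      P.map (prod.map (prod.fst : X ⨯ Y ⟶ X) (prod.fst : X ⨯ Y ⟶ X)).op (δ X)
          ⊓ P.map (prod.map (prod.snd : X ⨯ Y ⟶ Y) (prod.snd : X ⨯ Y ⟶ Y)).op (δ Y)
        ≤ δ (X ⨯ Y)) :
    ((∀ {X W : C} (p₁ p₂ : W ⟶ X) (_hp : IsWeakPair p₁ p₂) (d : X ⟶ W),
        d ≫ p₁ = 𝟙 X → d ≫ p₂ = 𝟙 X →
        ⊤ ≤ P.map d.op (P.map (prod.lift p₁ p₂).op (δ X))) ∧
      (∀ {X W : C} (p₁ p₂ : W ⟶ X) (_hp : IsWeakPair p₁ p₂) (α : P.obj (op X)),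
        P.map p₁.op α ⊓ P.map (prod.lift p₁ p₂).op (δ X) ≤ P.map p₂.op α) ∧
      (∀ {X X' W W' : C} (p₁ p₂ : W ⟶ X) (p'₁ p'₂ : W' ⟶ X')
          (_hp : IsWeakPair p₁ p₂) (_hp' : IsWeakPair p'₁ p'₂) (f : X' ⟶ X) (g : W' ⟶ W),
        g ≫ p₁ = p'₁ ≫ f → g ≫ p₂ = p'₂ ≫ f →
        P.map (prod.lift p'₁ p'₂).op (δ X') ≤ P.map g.op (P.map (prod.lift p₁ p₂).op (δ X))) ∧
      (∀ {X W U : C} (p₁ p₂ : W ⟶ X) (r₁ r₂ : U ⟶ W)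
          (_hp : IsWeakPair p₁ p₂) (_hr : IsWeakPair r₁ r₂) (t t' : U ⟶ W),
        t ≫ p₁ = r₁ ≫ p₁ → t ≫ p₂ = r₂ ≫ p₁ →
        t' ≫ p₁ = r₁ ≫ p₂ → t' ≫ p₂ = r₂ ≫ p₂ →
        P.map r₁.op (P.map (prod.lift p₁ p₂).op (δ X))
            ⊓ P.map t.op (P.map (prod.lift p₁ p₂).op (δ X))
            ⊓ P.map t'.op (P.map (prod.lift p₁ p₂).op (δ X))
          ≤ P.map r₂.op (P.map (prod.lift p₁ p₂).op (δ X)))) ∧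
    ∃ D : BiasedElementaryDoctrine C, D.P = P := by
  have c1 : ∀ {X W : C} (p₁ p₂ : W ⟶ X) (_hp : IsWeakPair p₁ p₂) (d : X ⟶ W),
        d ≫ p₁ = 𝟙 X → d ≫ p₂ = 𝟙 X →
        ⊤ ≤ P.map d.op (P.map (prod.lift p₁ p₂).op (δ X)) := by
    intro X W p₁ p₂ _ d e₁ e₂
    rw [bed_map_comp, prod.comp_lift, e₁, e₂]
    exact bed_refl P δ h1 _
  have c2 : ∀ {X W : C} (p₁ p₂ : W ⟶ X) (_hp : IsWeakPair p₁ p₂) (α : P.obj (op X)),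
        P.map p₁.op α ⊓ P.map (prod.lift p₁ p₂).op (δ X) ≤ P.map p₂.op α :=
    fun p₁ p₂ _ α => bed_subst P δ h2 p₁ p₂ α
  have c3 : ∀ {X X' W W' : C} (p₁ p₂ : W ⟶ X) (p'₁ p'₂ : W' ⟶ X')
          (_hp : IsWeakPair p₁ p₂) (_hp' : IsWeakPair p'₁ p'₂) (f : X' ⟶ X) (g : W' ⟶ W),
        g ≫ p₁ = p'₁ ≫ f → g ≫ p₂ = p'₂ ≫ f →
        P.map (prod.lift p'₁ p'₂).op (δ X')
          ≤ P.map g.op (P.map (prod.lift p₁ p₂).op (δ X)) := by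
    intro X X' W W' p₁ p₂ q₁ q₂ _ _ f g e₁ e₂
    rw [bed_map_comp, prod.comp_lift, e₁, e₂]
    have h := bed_subst P δ h2 (prod.lift q₁ q₁) (prod.lift q₁ q₂)
      (P.map (prod.map f f).op (δ X))
    rw [bed_map_comp, bed_map_comp, prod.lift_map, prod.lift_map] at h
    refine le_trans (le_inf ?_ ?_) h
    · exact le_trans le_top (bed_refl P δ h1 _)
    · exact le_trans (le_inf (le_trans le_top (bed_refl P δ h1 q₁)) le_rfl)
        (bed_pair P δ h3 q₁ q₁ q₁ q₂)
  have c4 : ∀ {X W U : C} (p₁ p₂ : W ⟶ X) (r₁ r₂ : U ⟶ W)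
          (_hp : IsWeakPair p₁ p₂) (_hr : IsWeakPair r₁ r₂) (t t' : U ⟶ W),
        t ≫ p₁ = r₁ ≫ p₁ → t ≫ p₂ = r₂ ≫ p₁ →
        t' ≫ p₁ = r₁ ≫ p₂ → t' ≫ p₂ = r₂ ≫ p₂ →
        P.map r₁.op (P.map (prod.lift p₁ p₂).op (δ X))
            ⊓ P.map t.op (P.map (prod.lift p₁ p₂).op (δ X))
            ⊓ P.map t'.op (P.map (prod.lift p₁ p₂).op (δ X))
          ≤ P.map r₂.op (P.map (prod.lift p₁ p₂).op (δ X)) := by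
    intro X W U p₁ p₂ r₁ r₂ _ _ t t' e₁ e₂ e₃ e₄
    simp only [bed_map_comp, prod.comp_lift, e₁, e₂, e₃, e₄]
    rw [inf_assoc]
    exact le_trans (inf_le_inf_left _ (bed_pair P δ h3 _ _ _ _))
      (bed_subst P δ h2 _ _ (δ X))
  refine ⟨⟨c1, c2, c3, c4⟩, ⟨⟨P, fun {X W p₁ p₂} _ => P.map (prod.lift p₁ p₂).op (δ X),
    ?_, ?_, ?_, ?_⟩, rfl⟩⟩
  · intro X W p₁ p₂ hp d
    exact c1 p₁ p₂ hp d
  · intro X W p₁ p₂ hp α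
    exact c2 p₁ p₂ hp α
  · intro X X' W W' p₁ p₂ q₁ q₂ hp hq f g
    exact c3 p₁ p₂ q₁ q₂ hp hq f g
  · intro X W U p₁ p₂ r₁ r₂ hp hr t t'
    exact c4 p₁ p₂ r₁ r₂ hp hr t t'
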